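/- Fix θ ∈ (0,1) and real numbers r₁, r₂ with 1−θ < r₁ < r₂ < 1+θ. Then there exists γ ∈ (0,1) such that for every positive integer n that is a multiple of K, the conditional probability P( ‖X_n(σ) − μ‖₂ ∈ (r₁·S_n·√K, r₂·S_n·√K) | ‖X_n(σ) − μ‖₂ ∈ ((1−θ)·S_n·√K, (1+θ)·S_n·√K) ) is equal to γ; in particular this conditional probability is strictly positive and does not depend on n. (Proposition 2: conditionally on lying in the annulus D_η, the realizations of the Concentrated Search regime fill the annulus, uniformly in n.) -/

import Mathlib

open MeasureTheory ProbabilityTheory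

/-- The open annulus around `m` of radii `a` and `b` for the Euclidean norm. -/
def euclideanAnnulus {ι : Type*} [Fintype ι] (m : ι → ℝ) (a b : ℝ) : Set (ι → ℝ) :=
  {x | Real.sqrt (∑ k, (x k - m k) ^ 2) ∈ Set.Ioo a b}

lemma isOpen_euclideanAnnulus {ι : Type*} [Fintype ι] (m : ι → ℝ) (a b : ℝ) :
    IsOpen (euclideanAnnulus m a b) :=
  isOpen_Ioo.preimage (by fun_prop)

lemma euclideanAnnulus_nonempty {ι : Type*} [Fintype ι] [Nonempty ι] (m : ι → ℝ) {a b : ℝ}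
    (ha : 0 ≤ a) (hab : a < b) : (euclideanAnnulus m a b).Nonempty := by
  classical
  obtain ⟨i⟩ := ‹Nonempty ι›
  obtain ⟨t, ht⟩ := exists_between hab
  refine ⟨m + Pi.single i t, ?_⟩
  have hsum : ∑ k, ((m + Pi.single i t : ι → ℝ) k - m k) ^ 2 = t ^ 2 := by
    simp [Pi.single_apply, ite_pow]
  rw [euclideanAnnulus, Set.mem_ofPred_eq, hsum, Real.sqrt_sq (ha.trans ht.1.le)]
  exact ht

lemma euclideanAnnulus_subset {ι : Type*} [Fintype ι] (m : ι → ℝ) {a b a₁ b₁ : ℝ}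
    (ha : a₁ ≤ a) (hb : b ≤ b₁) : euclideanAnnulus m a b ⊆ euclideanAnnulus m a₁ b₁ :=
  fun _ hx => Set.Ioo_subset_Ioo ha hb hx

/-- Homotheties map centred annuli to annuli. -/
lemma preimage_euclideanAnnulus {ι : Type*} [Fintype ι] (m : ι → ℝ) {c : ℝ} (hc : 0 < c)
    (a b : ℝ) :
    (fun (z : ι → ℝ) k => m k + c * z k) ⁻¹' euclideanAnnulus m (c * a) (c * b) =
      euclideanAnnulus 0 a b := by
  ext z
  have hsqrt : Real.sqrt (∑ k, (m k + c * z k - m k) ^ 2) = c * Real.sqrt (∑ k, z k ^ 2) := by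
    simp only [add_sub_cancel_left, mul_pow, ← Finset.mul_sum]
    rw [Real.sqrt_mul (sq_nonneg c), Real.sqrt_sq hc.le]
  simp only [euclideanAnnulus, Set.mem_preimage, Set.mem_ofPred_eq, hsqrt, Set.mem_Ioo,
    Pi.zero_apply, sub_zero, mul_lt_mul_iff_right₀ hc]

/-- A product of Gaussians is the image of the centred product under a homothety. -/
lemma map_pi_gaussianReal {ι : Type*} [Fintype ι] (m s : ι → ℝ) (c : ℝ) :
    (Measure.pi fun k => gaussianReal 0 (Real.toNNReal (s k ^ 2))).map
        (fun z k => m k + c * z k) =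
      Measure.pi fun k => gaussianReal (m k) (Real.toNNReal (c ^ 2 * s k ^ 2)) := by
  have hmap (k : ι) : (gaussianReal 0 (Real.toNNReal (s k ^ 2))).map (fun x => m k + c * x) =
      gaussianReal (m k) (Real.toNNReal (c ^ 2 * s k ^ 2)) := by
    have hcomp : (fun x => m k + c * x) = (m k + ·) ∘ (c * ·) := rfl
    rw [hcomp, ← Measure.map_map (by fun_prop) (by fun_prop), gaussianReal_map_const_mul,
      gaussianReal_map_const_add, Real.toNNReal_mul (sq_nonneg c)]
    congr 1
    · simp
    · congr 1
      ext
      simp [sq_nonneg]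
  simp only [← hmap]
  have (k : ι) : SigmaFinite
      ((gaussianReal 0 (Real.toNNReal (s k ^ 2))).map (fun x => m k + c * x)) := by
    rw [hmap k]
    infer_instance
  exact Measure.pi_map_pi (f := fun k x => m k + c * x) fun k => by fun_prop

/-- For a finite measure charging all nonempty open sets, the conditional probability of a proper
sub-annulus lies strictly between `0` and `1`. -/
lemma cond_euclideanAnnulus_mem_Ioo {ι : Type*} [Fintype ι] [Nonempty ι]
    (ν : Measure (ι → ℝ)) [IsFiniteMeasure ν] [ν.IsOpenPosMeasure] (m : ι → ℝ) {a a₁ b b₁ : ℝ}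
    (ha : 0 ≤ a) (ha₁ : a < a₁) (hab : a₁ < b₁) (hb₁ : b₁ ≤ b) :
    ν[|euclideanAnnulus m a b] (euclideanAnnulus m a₁ b₁) ∈ Set.Ioo 0 1 := by
  have hpos {u v : ℝ} (hu : 0 ≤ u) (huv : u < v) : 0 < ν (euclideanAnnulus m u v) :=
    (isOpen_euclideanAnnulus m u v).measure_pos ν (euclideanAnnulus_nonempty m hu huv)
  have hsub : euclideanAnnulus m a₁ b₁ ⊆ euclideanAnnulus m a b :=
    euclideanAnnulus_subset m ha₁.le hb₁
  have hdisj : Disjoint (euclideanAnnulus m a₁ b₁) (euclideanAnnulus m a a₁) :=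
    Set.disjoint_left.2 fun _ hx hy => lt_asymm hx.1 hy.2
  have hlt : ν (euclideanAnnulus m a₁ b₁) < ν (euclideanAnnulus m a b) := calc
    _ < ν (euclideanAnnulus m a₁ b₁) + ν (euclideanAnnulus m a a₁) :=
      ENNReal.lt_add_right (measure_ne_top _ _) (hpos ha ha₁).ne'
    _ = ν (euclideanAnnulus m a₁ b₁ ∪ euclideanAnnulus m a a₁) :=
      (measure_union hdisj (isOpen_euclideanAnnulus m a a₁).measurableSet).symm
    _ ≤ ν (euclideanAnnulus m a b) :=
      measure_mono (Set.union_subset hsub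
        (euclideanAnnulus_subset m le_rfl (hab.le.trans hb₁)))
  rw [cond_apply (isOpen_euclideanAnnulus m a b).measurableSet,
    Set.inter_eq_self_of_subset_right hsub, mul_comm, ← div_eq_mul_inv]
  exact ⟨ENNReal.div_pos (hpos (ha.trans ha₁.le) hab).ne' (measure_ne_top _ _),
    ENNReal.div_lt_of_lt_mul' (by simpa using hlt)⟩

/-- Proposition 2 of the paper: conditionally on lying in the annulus
`D = ((1−θ)S_n√K, (1+θ)S_n√K)` around `μ`, the Euclidean norm of the Concentrated Search
vector `X_n(σ)` lies in a fixed sub-annulus `(r₁·S_n√K, r₂·S_n√K)` with a conditional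
probability `γ ∈ (0,1)` which does not depend on `n` (here `S_n = σ̄/√(nK)`). -/
theorem cs_fills_annulus
    (K : ℕ) (hK : 1 ≤ K)
    (μ σ : Fin K → ℝ) (hσ : ∀ k, 0 < σ k)
    (σbar : ℝ) (hσbar : IsGreatest (Set.range σ) σbar)
    (θ : ℝ) (hθ : θ ∈ Set.Ioo (0 : ℝ) 1)
    (r₁ r₂ : ℝ) (hr₁ : 1 - θ < r₁) (hr₁₂ : r₁ < r₂) (hr₂ : r₂ < 1 + θ) :
    ∃ γ ∈ Set.Ioo (0 : ℝ) 1, ∀ n : ℕ, 0 < n → K ∣ n →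
      (ProbabilityTheory.cond
          (Measure.pi (fun k => gaussianReal (μ k) (Real.toNNReal ((σ k) ^ 2 / (n * K)))))
          {x : Fin K → ℝ |
            Real.sqrt (∑ k, (x k - μ k) ^ 2) ∈
              Set.Ioo ((1 - θ) * (σbar / Real.sqrt (n * K)) * Real.sqrt K)
                      ((1 + θ) * (σbar / Real.sqrt (n * K)) * Real.sqrt K)})
        {x : Fin K → ℝ |
          Real.sqrt (∑ k, (x k - μ k) ^ 2) ∈
            Set.Ioo (r₁ * (σbar / Real.sqrt (n * K)) * Real.sqrt K)
                    (r₂ * (σbar / Real.sqrt (n * K)) * Real.sqrt K)}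
      = ENNReal.ofReal γ := by
  have : Nonempty (Fin K) := ⟨⟨0, hK⟩⟩
  obtain ⟨k₀, hk₀⟩ := hσbar.1
  have hσbar_pos : 0 < σbar := hk₀ ▸ hσ k₀
  have hK_pos : (0 : ℝ) < K := by exact_mod_cast hK
  have hR : 0 < σbar * Real.sqrt K := mul_pos hσbar_pos (Real.sqrt_pos.2 hK_pos)
  have hvar (k : Fin K) : Real.toNNReal (σ k ^ 2) ≠ 0 :=
    (Real.toNNReal_pos.2 (pow_pos (hσ k) 2)).ne'
  have (k : Fin K) : (gaussianReal 0 (Real.toNNReal (σ k ^ 2))).IsOpenPosMeasure :=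
    (gaussianReal_absolutelyContinuous' 0 (hvar k)).isOpenPosMeasure
  set R := σbar * Real.sqrt K
  set ν := Measure.pi fun k => gaussianReal 0 (Real.toNNReal (σ k ^ 2))
  have hγ := cond_euclideanAnnulus_mem_Ioo ν 0 (a := (1 - θ) * R) (b := (1 + θ) * R)
    (a₁ := r₁ * R) (b₁ := r₂ * R) (mul_nonneg (sub_nonneg.2 hθ.2.le) hR.le)
    (by gcongr) (by gcongr) (by gcongr)
  have hγ_top := (hγ.2.trans ENNReal.one_lt_top).ne
  refine ⟨_, ⟨ENNReal.toReal_pos hγ.1.ne' hγ_top, ?_⟩, fun n hn _ => ?_⟩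
  · simpa using (ENNReal.toReal_lt_toReal hγ_top ENNReal.one_ne_top).2 hγ.2
  rw [ENNReal.ofReal_toReal hγ_top]
  have hnK : (0 : ℝ) < n * K := mul_pos (by exact_mod_cast hn) hK_pos
  set c := (Real.sqrt (n * K))⁻¹ with hc_def
  have hc : 0 < c := inv_pos.2 (Real.sqrt_pos.2 hnK)
  have hlaw : (Measure.pi fun k => gaussianReal (μ k) (Real.toNNReal (σ k ^ 2 / (n * K)))) =
      ν.map fun z k => μ k + c * z k := by
    rw [map_pi_gaussianReal μ σ c, hc_def, inv_pow, Real.sq_sqrt hnK.le]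
    simp only [div_eq_inv_mul]
  have hradius (r : ℝ) : r * (σbar / Real.sqrt (n * K)) * Real.sqrt K = c * (r * R) := by
    simp only [c, R]
    ring
  simp only [hradius, hlaw]
  change (ν.map fun z k => μ k + c * z k)[|euclideanAnnulus μ (c * ((1 - θ) * R))
    (c * ((1 + θ) * R))] (euclideanAnnulus μ (c * (r₁ * R)) (c * (r₂ * R))) = _
  have hmeas (m : Fin K → ℝ) (a b : ℝ) := (isOpen_euclideanAnnulus m a b).measurableSet
  rw [cond_apply (hmeas _ _ _), cond_apply (hmeas _ _ _),
    Measure.map_apply (by fun_prop) (hmeas _ _ _),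
    Measure.map_apply (by fun_prop) ((hmeas _ _ _).inter (hmeas _ _ _)), Set.preimage_inter,
    preimage_euclideanAnnulus μ hc, preimage_euclideanAnnulus μ hc]
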